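/- Let N ≥ 2 and let i ≠ j be fixed indices in {1,…,N}. If X is uniformly distributed on Δ_{N−1} and U is uniformly distributed on [0,1], independent of X, then T_{i,j,U}(X) is uniformly distributed on Δ_{N−1}. Consequently the uniform distribution U on Δ_{N−1} is invariant for the coagulation–fragmentation kernel K: ∫ K(x, A) dU(x) = U(A) for every Borel set A ⊆ Δ_{N−1}. -/

import Mathlib

open MeasureTheory Filter
open scoped ENNReal NNReal Topology

/-- The coagulation–fragmentation map `T_{i,j,u}` on `ℝ^N`: the `i`-th coordinate of the
output is `u (x_i + x_j)`, the `j`-th coordinate is `(1-u)(x_i + x_j)`, and all other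
coordinates are unchanged. -/
noncomputable def cfT (N : ℕ) (i j : Fin N) (u : ℝ) (x : Fin N → ℝ) : Fin N → ℝ :=
  Function.update (Function.update x i (u * (x i + x j))) j ((1 - u) * (x i + x j))

/-- The coagulation–fragmentation kernel on the simplex `Δ_{N-1}`, viewed as a
measure-valued map: `K(x, A) = (1/(N(N-1))) ∑_{(i,j) : i ≠ j} Leb{u ∈ [0,1] : T_{i,j,u}(x) ∈ A}`. -/
noncomputable def cfK (N : ℕ) (x : Fin N → ℝ) : Measure (Fin N → ℝ) :=
  ((N : ℝ≥0∞) * ((N : ℝ≥0∞) - 1))⁻¹ •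
    ∑ p ∈ Finset.univ.filter (fun p : Fin N × Fin N => p.1 ≠ p.2),
      (volume.restrict (Set.Icc (0 : ℝ) 1)).map (fun u => cfT N p.1 p.2 u x)

/-- The uniform distribution on the simplex `Δ_{N-1}`: the `(N-1)`-dimensional Hausdorff
measure restricted to `Δ_{N-1}` and normalized to be a probability measure. -/
noncomputable def uniformSimplex (N : ℕ) : Measure (Fin N → ℝ) :=
  (μH[(N : ℝ) - 1] (stdSimplex ℝ (Fin N)))⁻¹ •
    μH[(N : ℝ) - 1].restrict (stdSimplex ℝ (Fin N))

/-- Iterated action of a (measure-valued) Markov transition `κ` on an initial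
distribution: `evolve κ k μ = μ κ^k` is the time-`k` marginal of the chain with initial
distribution `μ` and transition kernel `κ`. -/
noncomputable def evolve {α : Type*} [MeasurableSpace α] (κ : α → Measure α) :
    ℕ → Measure α → Measure α
  | 0, μ => μ
  | k + 1, μ => (evolve κ k μ).bind κ

/-- The pushforward of a Haar measure under an injective affine map is, up to a constant, the
Hausdorff measure on the range of that map. -/
theorem exists_hausdorffMeasure_restrict_range_eq_smul_map {E F : Type*}
    [NormedAddCommGroup E] [NormedSpace ℝ E] [FiniteDimensional ℝ E] [MeasurableSpace E]
    [BorelSpace E] [NormedAddCommGroup F] [NormedSpace ℝ F] [MeasurableSpace F] [BorelSpace F]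
    (μ : Measure E) [μ.IsAddHaarMeasure] (L : E →ₗ[ℝ] F) (hL : Function.Injective L) (b : F) :
    ∃ c : ℝ≥0, μH[Module.finrank ℝ E].restrict (Set.range fun x => L x + b) =
      c • μ.map (fun x => L x + b) := by
  have : ProperSpace E := FiniteDimensional.proper ℝ E
  have hLip : LipschitzWith ‖L.toContinuousLinearMap‖₊ (fun x => L x + b) :=
    LipschitzWith.of_dist_le_mul fun x y => by
      simpa using L.toContinuousLinearMap.lipschitz.dist_le_mul x y
  have hinj : Function.Injective (fun x => L x + b) := fun x y h => hL (add_right_cancel h)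
  have hφ : MeasurableEmbedding (fun x => L x + b) := hLip.continuous.measurableEmbedding hinj
  set ν : Measure E := (μH[Module.finrank ℝ E] : Measure F).comap (fun x => L x + b) with hν
  have hfin : IsFiniteMeasureOnCompacts ν := by
    refine ⟨fun K hK => ?_⟩
    rw [hν, hφ.comap_apply]
    refine (hLip.hausdorffMeasure_image_le (Nat.cast_nonneg _) K).trans_lt ?_
    exact ENNReal.mul_lt_top (ENNReal.rpow_lt_top_of_nonneg (Nat.cast_nonneg _) ENNReal.coe_ne_top)
      hK.measure_lt_top
  have hinv : ν.IsAddLeftInvariant := by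
    refine ⟨fun w => Measure.ext fun A hA => ?_⟩
    rw [Measure.map_apply (measurable_const_add w) hA, hν, hφ.comap_apply, hφ.comap_apply,
      ← (IsometryEquiv.addLeft (L w)).hausdorffMeasure_preimage _ ((fun x => L x + b) '' A)]
    congr 1
    ext y
    simp only [Set.mem_image, Set.mem_preimage, IsometryEquiv.addLeft_apply]
    constructor
    · rintro ⟨x, hx, rfl⟩
      exact ⟨w + x, hx, by rw [map_add, add_assoc]⟩
    · rintro ⟨x, hx, h⟩
      refine ⟨x - w, by simpa using hx, ?_⟩
      rw [map_sub, sub_add_eq_add_sub, h, add_sub_cancel_left]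
  refine ⟨Measure.addHaarScalarFactor ν μ, ?_⟩
  rw [← hφ.map_comap, ← Measure.map_smul, ← Measure.isAddLeftInvariant_eq_smul ν μ]

/-- The linear part of the chart of the hyperplane `∑ k, x k = 1` whose coordinates are all `x k`
with `k ≠ i, j`, together with `x i`. -/
def hyperplaneChart (N : ℕ) (i j : Fin N) :
    ({k : Fin N // k ≠ i ∧ k ≠ j} → ℝ) × ℝ →ₗ[ℝ] (Fin N → ℝ) where
  toFun p k := if h : k ≠ i ∧ k ≠ j then p.1 ⟨k, h⟩ else if k = i then p.2 else -∑ l, p.1 l - p.2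
  map_add' p q := by
    ext k
    simp only [Pi.add_apply, Prod.fst_add, Prod.snd_add, Finset.sum_add_distrib]
    split_ifs <;> ring
  map_smul' r p := by
    ext k
    simp only [Pi.smul_apply, Prod.smul_fst, Prod.smul_snd, smul_eq_mul, RingHom.id_apply,
      ← Finset.mul_sum]
    split_ifs <;> ring

section Chart

variable {N : ℕ} {i j : Fin N}

theorem hyperplaneChart_apply_other (p : ({k : Fin N // k ≠ i ∧ k ≠ j} → ℝ) × ℝ)
    (k : {k : Fin N // k ≠ i ∧ k ≠ j}) :
    (hyperplaneChart N i j p + Pi.single j 1 : Fin N → ℝ) k = p.1 k := by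
  simp [hyperplaneChart, k.2.1, k.2.2]

theorem hyperplaneChart_apply_left (hij : i ≠ j)
    (p : ({k : Fin N // k ≠ i ∧ k ≠ j} → ℝ) × ℝ) :
    (hyperplaneChart N i j p + Pi.single j 1 : Fin N → ℝ) i = p.2 := by
  simp [hyperplaneChart, hij]

theorem hyperplaneChart_apply_right (hij : i ≠ j)
    (p : ({k : Fin N // k ≠ i ∧ k ≠ j} → ℝ) × ℝ) :
    (hyperplaneChart N i j p + Pi.single j 1 : Fin N → ℝ) j = 1 - ∑ l, p.1 l - p.2 := by
  simp [hyperplaneChart, hij.symm]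
  ring

theorem hyperplaneChart_injective (hij : i ≠ j) : Function.Injective (hyperplaneChart N i j) := by
  intro p q h
  have h' : hyperplaneChart N i j p + Pi.single j 1 = hyperplaneChart N i j q + Pi.single j 1 := by
    rw [h]
  refine Prod.ext (funext fun k => ?_) ?_
  · rw [← hyperplaneChart_apply_other p k, h', hyperplaneChart_apply_other]
  · rw [← hyperplaneChart_apply_left hij p, h', hyperplaneChart_apply_left hij]

theorem sum_eq_add_add_sum_other (hij : i ≠ j) (x : Fin N → ℝ) :
    ∑ k, x k = x i + x j + ∑ k : {k : Fin N // k ≠ i ∧ k ≠ j}, x k := by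
  have h : ∑ k : {k : Fin N // k ≠ i ∧ k ≠ j}, x k = ∑ k ∈ (Finset.univ.erase i).erase j, x k :=
    (Finset.sum_subtype _ (by simp [and_comm]) _).symm
  rw [h, add_assoc, Finset.add_sum_erase _ _ (by simp [hij.symm]),
    Finset.add_sum_erase _ _ (Finset.mem_univ i)]

theorem eq_hyperplaneChart (hij : i ≠ j) {x : Fin N → ℝ} (hx : ∑ k, x k = 1) :
    hyperplaneChart N i j (fun k => x k, x i) + Pi.single j 1 = x := by
  ext k
  by_cases hi : k = i
  · rw [hi, hyperplaneChart_apply_left hij]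
  by_cases hj : k = j
  · rw [hj, hyperplaneChart_apply_right hij]
    linarith [sum_eq_add_add_sum_other hij x]
  exact hyperplaneChart_apply_other _ ⟨k, hi, hj⟩

theorem hyperplaneChart_mem_stdSimplex_iff (hij : i ≠ j)
    (p : ({k : Fin N // k ≠ i ∧ k ≠ j} → ℝ) × ℝ) :
    hyperplaneChart N i j p + Pi.single j 1 ∈ stdSimplex ℝ (Fin N) ↔
      0 ≤ p.1 ∧ p.2 ∈ Set.Icc 0 (1 - ∑ l, p.1 l) := by
  constructor
  · rintro ⟨h, -⟩
    refine ⟨fun k => (h k).trans_eq (hyperplaneChart_apply_other p k),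
      (h i).trans_eq (hyperplaneChart_apply_left hij p), ?_⟩
    have := (h j).trans_eq (hyperplaneChart_apply_right hij p)
    linarith
  · rintro ⟨h, h0, h1⟩
    refine ⟨fun k => ?_, ?_⟩
    · by_cases hi : k = i
      · rwa [hi, hyperplaneChart_apply_left hij]
      by_cases hj : k = j
      · rw [hj, hyperplaneChart_apply_right hij]
        linarith
      exact (h ⟨k, hi, hj⟩).trans_eq (hyperplaneChart_apply_other p ⟨k, hi, hj⟩).symm
    · rw [sum_eq_add_add_sum_other hij, hyperplaneChart_apply_left hij,
        hyperplaneChart_apply_right hij]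
      simp only [hyperplaneChart_apply_other]
      ring

theorem cfT_hyperplaneChart (hij : i ≠ j) (u : ℝ)
    (p : ({k : Fin N // k ≠ i ∧ k ≠ j} → ℝ) × ℝ) :
    cfT N i j u (hyperplaneChart N i j p + Pi.single j 1) =
      hyperplaneChart N i j (p.1, u * (1 - ∑ l, p.1 l)) + Pi.single j 1 := by
  ext k
  by_cases hj : k = j
  · rw [hj, cfT, Function.update_self, hyperplaneChart_apply_left hij,
      hyperplaneChart_apply_right hij, hyperplaneChart_apply_right hij]
    ring
  rw [cfT, Function.update_of_ne hj]
  by_cases hi : k = i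
  · rw [hi, Function.update_self, hyperplaneChart_apply_left hij,
      hyperplaneChart_apply_right hij, hyperplaneChart_apply_left hij]
    ring
  rw [Function.update_of_ne hi]
  exact (hyperplaneChart_apply_other p ⟨k, hi, hj⟩).trans
    (hyperplaneChart_apply_other (p.1, u * (1 - ∑ l, p.1 l)) ⟨k, hi, hj⟩).symm

theorem finrank_hyperplane (hij : i ≠ j) :
    (Module.finrank ℝ (({k : Fin N // k ≠ i ∧ k ≠ j} → ℝ) × ℝ) : ℝ) = N - 1 := by
  have h := sum_eq_add_add_sum_other hij fun _ => 1
  simp only [Finset.sum_const, Finset.card_univ, Fintype.card_fin, nsmul_eq_mul, mul_one] at h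
  rw [Module.finrank_prod, Module.finrank_fintype_fun_eq_card, Module.finrank_self]
  push_cast
  linarith

/-- Integration over the standard simplex in the coordinates of `hyperplaneChart`. -/
theorem exists_lintegral_stdSimplex_eq (hij : i ≠ j) :
    ∃ c : ℝ≥0, ∀ f : (Fin N → ℝ) → ℝ≥0∞, Measurable f →
      ∫⁻ x in stdSimplex ℝ (Fin N), f x ∂μH[(N : ℝ) - 1] =
        c * ∫⁻ z : {k : Fin N // k ≠ i ∧ k ≠ j} → ℝ in Set.Ici 0,
          ∫⁻ t in Set.Icc 0 (1 - ∑ l, z l),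
            f (hyperplaneChart N i j (z, t) + Pi.single j 1) := by
  obtain ⟨c, hc⟩ := exists_hausdorffMeasure_restrict_range_eq_smul_map
    ((volume : Measure ({k : Fin N // k ≠ i ∧ k ≠ j} → ℝ)).prod (volume : Measure ℝ))
    (hyperplaneChart N i j) (hyperplaneChart_injective hij) (Pi.single j 1)
  rw [finrank_hyperplane hij] at hc
  have hφ : Measurable fun p => hyperplaneChart N i j p + Pi.single j 1 :=
    (hyperplaneChart N i j).continuous_of_finiteDimensional.measurable.add_const _
  have hΔ : MeasurableSet (stdSimplex ℝ (Fin N)) := (isClosed_stdSimplex ℝ (Fin N)).measurableSet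
  refine ⟨c, fun f hf => ?_⟩
  have hsub : stdSimplex ℝ (Fin N) ⊆ Set.range fun p =>
      hyperplaneChart N i j p + Pi.single j 1 := fun x hx => ⟨_, eq_hyperplaneChart hij hx.2⟩
  have hrestrict : (μH[(N : ℝ) - 1]).restrict (stdSimplex ℝ (Fin N)) =
      c • ((volume.prod volume).map fun p => hyperplaneChart N i j p + Pi.single j 1).restrict
        (stdSimplex ℝ (Fin N)) := by
    rw [← Measure.restrict_smul, ← hc, Measure.restrict_restrict hΔ,
      Set.inter_eq_left.2 hsub]
  rw [hrestrict, lintegral_smul_measure, ENNReal.smul_def, smul_eq_mul,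
    ← lintegral_indicator hΔ, lintegral_map (hf.indicator hΔ) hφ,
    lintegral_prod _ (by exact ((hf.indicator hΔ).comp hφ).aemeasurable),
    ← lintegral_indicator measurableSet_Ici]
  congr 2 with z
  by_cases hz : 0 ≤ z
  · rw [Set.indicator_of_mem hz, ← lintegral_indicator measurableSet_Icc]
    congr 1 with t
    by_cases ht : t ∈ Set.Icc 0 (1 - ∑ l, z l)
    · rw [Set.indicator_of_mem ht, Set.indicator_of_mem]
      exact (hyperplaneChart_mem_stdSimplex_iff hij _).2 ⟨hz, ht⟩
    · rw [Set.indicator_of_notMem ht, Set.indicator_of_notMem]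
      exact fun h => ht ((hyperplaneChart_mem_stdSimplex_iff hij _).1 h).2
  · rw [Set.indicator_of_notMem (by simpa using hz)]
    refine (lintegral_congr fun t => Set.indicator_of_notMem ?_ _).trans lintegral_zero
    exact fun h => hz ((hyperplaneChart_mem_stdSimplex_iff hij _).1 h).1

theorem measurable_cfT (i j : Fin N) :
    Measurable fun p : (Fin N → ℝ) × ℝ => cfT N i j p.2 p.1 := by
  refine measurable_pi_lambda _ fun k => ?_
  simp only [cfT, Function.update_apply]
  split_ifs <;> fun_prop

theorem measurable_cfT_left (i j : Fin N) (x : Fin N → ℝ) :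
    Measurable fun u => cfT N i j u x :=
  (measurable_cfT i j).comp (by fun_prop : Measurable fun u : ℝ => (x, u))

end Chart

theorem lintegral_Icc_mul_right {g : ℝ → ℝ≥0∞} (hg : Measurable g) (s : ℝ) :
    ENNReal.ofReal s * ∫⁻ u in Set.Icc (0 : ℝ) 1, g (u * s) = ∫⁻ t in Set.Icc 0 s, g t := by
  rcases le_or_gt s 0 with hs | hs
  · rw [ENNReal.ofReal_of_nonpos hs, zero_mul, setLIntegral_measure_zero]
    simpa using hs
  · conv_rhs => rw [← Real.smul_map_volume_mul_right hs.ne', abs_of_pos hs,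
      Measure.restrict_smul, lintegral_smul_measure, smul_eq_mul,
      setLIntegral_map measurableSet_Icc hg (by fun_prop)]
    congr 4
    ext u
    simp only [Set.mem_Icc, Set.mem_preimage, mul_nonneg_iff_of_pos_right hs,
      mul_le_iff_le_one_left hs]

theorem lintegral_lintegral_cfT {N : ℕ} {i j : Fin N} (hij : i ≠ j)
    {f : (Fin N → ℝ) → ℝ≥0∞} (hf : Measurable f) :
    ∫⁻ x, (∫⁻ u in Set.Icc (0 : ℝ) 1, f (cfT N i j u x)) ∂uniformSimplex N =
      ∫⁻ x, f x ∂uniformSimplex N := by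
  obtain ⟨c, hc⟩ := exists_lintegral_stdSimplex_eq hij
  have hmeas : Measurable fun x => ∫⁻ u in Set.Icc (0 : ℝ) 1, f (cfT N i j u x) :=
    (hf.comp (measurable_cfT i j)).lintegral_prod_right'
  rw [uniformSimplex, lintegral_smul_measure, lintegral_smul_measure, hc f hf, hc _ hmeas]
  congr 3 with z
  simp only [cfT_hyperplaneChart hij]
  have hg : Measurable fun t => f (hyperplaneChart N i j (z, t) + Pi.single j 1) :=
    hf.comp (((hyperplaneChart N i j).continuous_of_finiteDimensional.measurable.comp
      (by fun_prop : Measurable fun t : ℝ => (z, t))).add_const _)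
  rw [← lintegral_Icc_mul_right hg, lintegral_const, mul_comm]
  simp

theorem measurable_map_cfT {N : ℕ} (i j : Fin N) :
    Measurable fun x =>
      (volume.restrict (Set.Icc (0 : ℝ) 1)).map fun u => cfT N i j u x := by
  refine Measure.measurable_of_measurable_coe _ fun A hA => ?_
  have h (x : Fin N → ℝ) : (volume.restrict (Set.Icc (0 : ℝ) 1)).map (fun u => cfT N i j u x) A =
      volume.restrict (Set.Icc (0 : ℝ) 1)
        (Prod.mk x ⁻¹' ((fun p : (Fin N → ℝ) × ℝ => cfT N i j p.2 p.1) ⁻¹' A)) :=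
    Measure.map_apply (measurable_cfT_left i j x) hA
  simp only [h]
  exact measurable_measure_prodMk_left (measurable_cfT i j hA)

theorem lintegral_map_cfT_apply {N : ℕ} {i j : Fin N} (hij : i ≠ j) {A : Set (Fin N → ℝ)}
    (hA : MeasurableSet A) :
    ∫⁻ x, (volume.restrict (Set.Icc (0 : ℝ) 1)).map (fun u => cfT N i j u x) A
      ∂uniformSimplex N = uniformSimplex N A := by
  rw [← lintegral_indicator_one hA, ← lintegral_lintegral_cfT hij (measurable_one.indicator hA)]
  refine lintegral_congr fun x => ?_
  rw [← lintegral_map (measurable_one.indicator hA)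
    (measurable_cfT_left i j x), lintegral_indicator_one hA]

theorem measurable_cfK (N : ℕ) : Measurable (cfK N) := by
  refine Measure.measurable_of_measurable_coe _ fun A hA => ?_
  simp only [cfK, Measure.smul_apply, Measure.finsetSum_apply, smul_eq_mul]
  exact (Finset.measurable_fun_sum _ fun p _ =>
    (Measure.measurable_coe hA).comp (measurable_map_cfT p.1 p.2)).const_mul _

theorem card_filter_ne (N : ℕ) :
    (((Finset.univ.filter fun p : Fin N × Fin N => p.1 ≠ p.2).card : ℕ) : ℝ≥0∞) =
      N * ((N : ℝ≥0∞) - 1) := by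
  have h : (Finset.univ.filter fun p : Fin N × Fin N => p.1 ≠ p.2) =
      (Finset.univ : Finset (Fin N)).offDiag := by
    ext p
    simp
  rw [h, Finset.offDiag_card, Finset.card_univ, Fintype.card_fin, ← Nat.mul_sub_one]
  push_cast
  rfl

/-- If `X` is uniformly distributed on the simplex `Δ_{N-1}` and `U` is uniform on `[0,1]`
and independent of `X`, then `T_{i,j,U}(X)` is again uniformly distributed on `Δ_{N-1}`.
Consequently, the uniform distribution on `Δ_{N-1}` is invariant for the
coagulation–fragmentation kernel `K`. -/
theorem uniformSimplex_invariant (N : ℕ) (hN : 2 ≤ N) (i j : Fin N) (hij : i ≠ j) :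
    (Measure.map (fun p : (Fin N → ℝ) × ℝ => cfT N i j p.2 p.1)
        ((uniformSimplex N).prod (volume.restrict (Set.Icc (0 : ℝ) 1)))
      = uniformSimplex N) ∧
    (uniformSimplex N).bind (cfK N) = uniformSimplex N := by
  refine ⟨Measure.ext_of_lintegral _ fun f hf => ?_, Measure.ext fun A hA => ?_⟩
  · rw [lintegral_map hf (measurable_cfT i j),
      lintegral_prod _ (by exact (hf.comp (measurable_cfT i j)).aemeasurable),
      lintegral_lintegral_cfT hij hf]
  · rw [Measure.bind_apply hA (measurable_cfK N).aemeasurable]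
    simp only [cfK, Measure.smul_apply, Measure.finsetSum_apply, smul_eq_mul]
    have hmeas (p : Fin N × Fin N) : Measurable fun x =>
        (volume.restrict (Set.Icc (0 : ℝ) 1)).map (fun u => cfT N p.1 p.2 u x) A :=
      (Measure.measurable_coe hA).comp (measurable_map_cfT p.1 p.2)
    rw [lintegral_const_mul _ (Finset.measurable_fun_sum _ fun p _ => hmeas p),
      lintegral_finsetSum _ fun p _ => hmeas p,
      Finset.sum_congr rfl fun p hp => lintegral_map_cfT_apply (Finset.mem_filter.1 hp).2 hA,
      Finset.sum_const, nsmul_eq_mul, ← card_filter_ne, ← mul_assoc, ENNReal.inv_mul_cancel,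
      one_mul]
    · exact_mod_cast Finset.card_ne_zero_of_mem (a := (i, j)) (by simpa using hij)
    · exact ENNReal.natCast_ne_top _
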